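/- Suppose S is harmonic. Then the matrices a and b built from the d^μ-parallel frame G satisfy, on U, the parallelity relations ∂ₓa = −[A_y T, a − E₂], ∂_ya = [A_x T, a − E₂], ∂ₓb = −[A_y T, b], and ∂_yb = [A_x T, b], where [P,R] := PR − RP (the coordinate form of d(a−1) = −[*AT, a−1] and db = −[*AT, b]). -/

import Mathlib

/- STATEMENT 11: Suppose S is harmonic. Then the matrices a and b built from the
d^μ-parallel frame G satisfy, on U, the parallelity relations
`∂ₓa = −[A_y T, a − E₂]`, `∂_ya = [A_x T, a − E₂]`,
`∂ₓb = −[A_y T, b]`, `∂_yb = [A_x T, b]`,  where `[P,R] = PR − RP`. -/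

open Matrix Quaternion

noncomputable section

attribute [local instance] Matrix.normedAddCommGroup Matrix.normedSpace

abbrev Hq : Type := ℍ[ℝ]
abbrev M2 : Type := Matrix (Fin 2) (Fin 2) Hq

/-- the standard embedding ℂ → ℍ (with `span_ℝ{1,i} = ℂ ⊂ ℍ`) -/
def cq (z : ℂ) : Hq := ⟨z.re, z.im, 0, 0⟩
/-- the quaternion `i` -/
def qi : Hq := ⟨0, 1, 0, 0⟩

/-- Hopf field component `A_x = ¼(∂_yS + S∂ₓS)` -/
def Ax (S Sx Sy : ℝ × ℝ → M2) (p : ℝ × ℝ) : M2 := (4 : ℝ)⁻¹ • (Sy p + S p * Sx p)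
/-- Hopf field component `A_y = ¼(−∂ₓS + S∂_yS)` -/
def Ay (S Sx Sy : ℝ × ℝ → M2) (p : ℝ × ℝ) : M2 := (4 : ℝ)⁻¹ • (-Sx p + S p * Sy p)
/-- Hopf field component `Q_x = ¼(S∂ₓS − ∂_yS)` -/
def Qx (S Sx Sy : ℝ × ℝ → M2) (p : ℝ × ℝ) : M2 := (4 : ℝ)⁻¹ • (S p * Sx p - Sy p)
/-- Hopf field component `Q_y = ¼(∂ₓS + S∂_yS)` -/
def Qy (S Sx Sy : ℝ × ℝ → M2) (p : ℝ × ℝ) : M2 := (4 : ℝ)⁻¹ • (Sx p + S p * Sy p)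

/-- connection form `ω^λ_x(v) = ½(A_x v − (A_y v)i)(λ−1) + ½(A_x v + (A_y v)i)(λ⁻¹−1)` -/
def omx (S Sx Sy : ℝ × ℝ → M2) (l : ℂ) (p : ℝ × ℝ) (v : Fin 2 → Hq) : Fin 2 → Hq :=
  fun n =>
    ((2 : ℝ)⁻¹ • ((Ax S Sx Sy p *ᵥ v) n - (Ay S Sx Sy p *ᵥ v) n * qi)) * cq (l - 1) +
    ((2 : ℝ)⁻¹ • ((Ax S Sx Sy p *ᵥ v) n + (Ay S Sx Sy p *ᵥ v) n * qi)) * cq (l⁻¹ - 1)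

/-- connection form `ω^λ_y(v) = ½(A_y v + (A_x v)i)(λ−1) + ½(A_y v − (A_x v)i)(λ⁻¹−1)` -/
def omy (S Sx Sy : ℝ × ℝ → M2) (l : ℂ) (p : ℝ × ℝ) (v : Fin 2 → Hq) : Fin 2 → Hq :=
  fun n =>
    ((2 : ℝ)⁻¹ • ((Ay S Sx Sy p *ᵥ v) n + (Ax S Sx Sy p *ᵥ v) n * qi)) * cq (l - 1) +
    ((2 : ℝ)⁻¹ • ((Ay S Sx Sy p *ᵥ v) n - (Ax S Sx Sy p *ᵥ v) n * qi)) * cq (l⁻¹ - 1)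

/-- the matrix `G = (ψ₁, ψ₂)` with columns `ψ₁` and `ψ₂` -/
def Gm (ψ1 ψ2 : Fin 2 → Hq) : M2 := Matrix.of fun i l => ![ψ1, ψ2] l i

/-- `a = G·((μ+μ⁻¹)/2 · E₂)·G⁻¹` -/
def am (μ : ℂ) (G : M2) : M2 :=
  G * Matrix.scalar (Fin 2) (cq ((μ + μ⁻¹) / 2)) * Ring.inverse G
/-- `b = G·((i(μ⁻¹−μ)/2) · E₂)·G⁻¹` -/
def bm (μ : ℂ) (G : M2) : M2 :=
  G * Matrix.scalar (Fin 2) (cq (Complex.I * (μ⁻¹ - μ) / 2)) * Ring.inverse G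
/-- `T = S(a−E₂) + b` -/
def Tm (S : M2) (μ : ℂ) (G : M2) : M2 := S * (am μ G - 1) + bm μ G

/-- `a` as a function on `U`, built from the parallel frame -/
def af (μ : ℂ) (ψ1 ψ2 : ℝ × ℝ → (Fin 2 → Hq)) (p : ℝ × ℝ) : M2 := am μ (Gm (ψ1 p) (ψ2 p))
/-- `b` as a function on `U`, built from the parallel frame -/
def bf (μ : ℂ) (ψ1 ψ2 : ℝ × ℝ → (Fin 2 → Hq)) (p : ℝ × ℝ) : M2 := bm μ (Gm (ψ1 p) (ψ2 p))
/-- `T = S(a−E₂) + b` as a function on `U` -/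
def Tf (S : ℝ × ℝ → M2) (μ : ℂ) (ψ1 ψ2 : ℝ × ℝ → (Fin 2 → Hq)) (p : ℝ × ℝ) : M2 :=
  Tm (S p) μ (Gm (ψ1 p) (ψ2 p))

@[simp] theorem re_cq (z : ℂ) : (cq z).re = z.re := rfl

@[simp] theorem imI_cq (z : ℂ) : (cq z).imI = z.im := rfl

@[simp] theorem imJ_cq (z : ℂ) : (cq z).imJ = 0 := rfl

@[simp] theorem imK_cq (z : ℂ) : (cq z).imK = 0 := rfl

@[simp] theorem re_qi : qi.re = 0 := rfl

@[simp] theorem imI_qi : qi.imI = 1 := rfl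

@[simp] theorem imJ_qi : qi.imJ = 0 := rfl

@[simp] theorem imK_qi : qi.imK = 0 := rfl

/-- The derivative of `g c g⁻¹` along a curve of units with `g' = w g` is the commutator
of `w` with `g c g⁻¹`. -/
theorem hasDerivAt_conj_inverse {R : Type*} [NormedRing R] [NormedAlgebra ℝ R] [CompleteSpace R]
    {g : ℝ → R} {w c : R} {t : ℝ} (hg : HasDerivAt g (w * g t) t) (hu : IsUnit (g t)) :
    HasDerivAt (fun s => g s * c * Ring.inverse (g s))
      (w * (g t * c * Ring.inverse (g t)) - g t * c * Ring.inverse (g t) * w) t := by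
  obtain ⟨u, hu⟩ := hu
  have hinv : HasFDerivAt Ring.inverse
      (-ContinuousLinearMap.mulLeftRight ℝ R (↑u⁻¹ : R) (↑u⁻¹ : R)) (g t) := by
    rw [← hu]; exact hasFDerivAt_ringInverse u
  refine ((hg.mul_const c).mul (hinv.comp_hasDerivAt t hg)).congr_deriv ?_
  have hv : (-ContinuousLinearMap.mulLeftRight ℝ R (↑u⁻¹ : R) (↑u⁻¹ : R)) (w * g t)
      = -((↑u⁻¹ : R) * w) := by
    change -((↑u⁻¹ : R) * (w * g t) * (↑u⁻¹ : R)) = _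
    simp [← hu, mul_assoc]
  rw [hv, Function.comp_apply, ← hu, Ring.inverse_unit]
  noncomm_ring

/-- The derivative of a curve of square roots of `-1` anticommutes with the curve. -/
theorem mul_deriv_eq_neg_of_mul_self_eq_neg_one {R : Type*} [NormedRing R] [NormedAlgebra ℝ R]
    {f : ℝ → R} {f' : R} {t : ℝ} (hf : HasDerivAt f f' t) (h : ∀ᶠ s in nhds t, f s * f s = -1) :
    f t * f' = -(f' * f t) := by
  have h0 : HasDerivAt (fun s => f s * f s) 0 t :=
    (hasDerivAt_const t (-1 : R)).congr_of_eventuallyEq h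
  have h1 := (hf.mul hf).unique h0
  rw [add_comm] at h1
  exact eq_neg_of_add_eq_zero_left h1

/-- The conjugation derivative formula, for the entrywise sup norm on matrices. -/
theorem hasDerivAt_matrix_conj_inverse {g : ℝ → M2} {w c : M2} {t : ℝ}
    (hg : HasDerivAt g (w * g t) t) (hu : IsUnit (g t)) :
    HasDerivAt (fun s => g s * c * Ring.inverse (g s))
      (w * (g t * c * Ring.inverse (g t)) - g t * c * Ring.inverse (g t) * w) t := by
  let _ : NormedRing M2 := Matrix.linftyOpNormedRing
  let _ : NormedAlgebra ℝ M2 := Matrix.linftyOpNormedAlgebra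
  exact @hasDerivAt_conj_inverse M2 _ _ (FiniteDimensional.complete ℝ (Fin 2 → Fin 2 → Hq))
    _ _ _ _ hg hu

/-- Anticommutation of a matrix curve of square roots of `-1` with its derivative, for the
entrywise sup norm on matrices. -/
theorem matrix_mul_deriv_eq_neg {f : ℝ → M2} {f' : M2} {t : ℝ}
    (hf : HasDerivAt f f' t) (h : ∀ᶠ s in nhds t, f s * f s = -1) :
    f t * f' = -(f' * f t) := by
  let _ : NormedRing M2 := Matrix.linftyOpNormedRing
  let _ : NormedAlgebra ℝ M2 := Matrix.linftyOpNormedAlgebra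
  exact mul_deriv_eq_neg_of_mul_self_eq_neg_one hf h

theorem hasDerivAt_Gm {ψ1 ψ2 : ℝ → (Fin 2 → Hq)} {v1 v2 : Fin 2 → Hq} {t : ℝ}
    (h1 : HasDerivAt ψ1 v1 t) (h2 : HasDerivAt ψ2 v2 t) :
    HasDerivAt (fun s => Gm (ψ1 s) (ψ2 s)) (Gm v1 v2) t := by
  refine hasDerivAt_pi.2 fun n => hasDerivAt_pi.2 fun l => ?_
  fin_cases l
  · exact hasDerivAt_pi.1 h1 n
  · exact hasDerivAt_pi.1 h2 n

theorem am_mul_self (μ : ℂ) {G : M2} (hG : IsUnit G) :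
    am μ G * G = G * Matrix.scalar (Fin 2) (cq ((μ + μ⁻¹) / 2)) := by
  rw [am, mul_assoc, Ring.inverse_mul_cancel _ hG, mul_one]

theorem bm_mul_self (μ : ℂ) {G : M2} (hG : IsUnit G) :
    bm μ G * G = G * Matrix.scalar (Fin 2) (cq (Complex.I * (μ⁻¹ - μ) / 2)) := by
  rw [bm, mul_assoc, Ring.inverse_mul_cancel _ hG, mul_one]

/-- Right multiplication of the columns of `G` by complex scalars. -/
theorem mul_Gm_mul_scalar_apply (P : M2) (ψ1 ψ2 : Fin 2 → Hq) (c : Hq) (n l : Fin 2) :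
    (P * (Gm ψ1 ψ2 * Matrix.scalar (Fin 2) c)) n l = (P *ᵥ ![ψ1, ψ2] l) n * c := by
  rw [← mul_assoc, Matrix.scalar_apply, Matrix.mul_diagonal]
  rfl

theorem omx_apply_eq (S Sx Sy : ℝ × ℝ → M2) (μ : ℂ) (p : ℝ × ℝ) (v : Fin 2 → Hq) (n : Fin 2) :
    omx S Sx Sy μ p v n = (Ax S Sx Sy p *ᵥ v) n * cq ((μ + μ⁻¹) / 2) - (Ax S Sx Sy p *ᵥ v) n
      + (Ay S Sx Sy p *ᵥ v) n * cq (Complex.I * (μ⁻¹ - μ) / 2) := by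
  unfold omx
  generalize (Ax S Sx Sy p *ᵥ v) n = X, (Ay S Sx Sy p *ᵥ v) n = Y, μ⁻¹ = m
  ext <;> simp [Quaternion.re_mul, Quaternion.imI_mul, Quaternion.imJ_mul,
    Quaternion.imK_mul] <;> ring

theorem omy_apply_eq (S Sx Sy : ℝ × ℝ → M2) (μ : ℂ) (p : ℝ × ℝ) (v : Fin 2 → Hq) (n : Fin 2) :
    omy S Sx Sy μ p v n = (Ay S Sx Sy p *ᵥ v) n * cq ((μ + μ⁻¹) / 2) - (Ay S Sx Sy p *ᵥ v) n
      - (Ax S Sx Sy p *ᵥ v) n * cq (Complex.I * (μ⁻¹ - μ) / 2) := by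
  unfold omy
  generalize (Ax S Sx Sy p *ᵥ v) n = X, (Ay S Sx Sy p *ᵥ v) n = Y, μ⁻¹ = m
  ext <;> simp [Quaternion.re_mul, Quaternion.imI_mul, Quaternion.imJ_mul,
    Quaternion.imK_mul] <;> ring

/-- The `x`-component of the connection acts on a frame as left multiplication by
`A_x (a - 1) + A_y b`. -/
theorem Gm_neg_omx (S Sx Sy : ℝ × ℝ → M2) (μ : ℂ) (p : ℝ × ℝ) {ψ1 ψ2 : Fin 2 → Hq}
    (hG : IsUnit (Gm ψ1 ψ2)) :
    Gm (-omx S Sx Sy μ p ψ1) (-omx S Sx Sy μ p ψ2)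
      = -(Ax S Sx Sy p * (am μ (Gm ψ1 ψ2) - 1) + Ay S Sx Sy p * bm μ (Gm ψ1 ψ2))
        * Gm ψ1 ψ2 := by
  rw [neg_mul, add_mul, mul_assoc, mul_assoc, sub_mul, am_mul_self μ hG, bm_mul_self μ hG,
    one_mul, mul_sub]
  ext1 n l
  rw [Matrix.neg_apply, Matrix.add_apply, Matrix.sub_apply, mul_Gm_mul_scalar_apply,
    mul_Gm_mul_scalar_apply]
  have h := omx_apply_eq S Sx Sy μ p (![ψ1, ψ2] l) n
  fin_cases l <;> exact congrArg Neg.neg h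

/-- The `y`-component of the connection acts on a frame as left multiplication by
`A_y (a - 1) - A_x b`. -/
theorem Gm_neg_omy (S Sx Sy : ℝ × ℝ → M2) (μ : ℂ) (p : ℝ × ℝ) {ψ1 ψ2 : Fin 2 → Hq}
    (hG : IsUnit (Gm ψ1 ψ2)) :
    Gm (-omy S Sx Sy μ p ψ1) (-omy S Sx Sy μ p ψ2)
      = -(Ay S Sx Sy p * (am μ (Gm ψ1 ψ2) - 1) - Ax S Sx Sy p * bm μ (Gm ψ1 ψ2))
        * Gm ψ1 ψ2 := by
  rw [neg_mul, sub_mul, mul_assoc, mul_assoc, sub_mul, am_mul_self μ hG, bm_mul_self μ hG,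
    one_mul, mul_sub]
  ext1 n l
  rw [Matrix.neg_apply, Matrix.sub_apply, Matrix.sub_apply, mul_Gm_mul_scalar_apply,
    mul_Gm_mul_scalar_apply]
  have h := omy_apply_eq S Sx Sy μ p (![ψ1, ψ2] l) n
  fin_cases l <;> exact congrArg Neg.neg h

theorem Ay_mul_self {S Sx Sy : ℝ × ℝ → M2} {p : ℝ × ℝ} (h : S p * S p = -1)
    (hx : S p * Sx p = -(Sx p * S p)) (hy : S p * Sy p = -(Sy p * S p)) :
    Ay S Sx Sy p * S p = Ax S Sx Sy p := by
  rw [Ay, Ax, smul_mul_assoc, hx, hy, add_mul, neg_mul, neg_mul, mul_assoc (Sy p), h, mul_neg,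
    mul_one, neg_neg, add_comm]

theorem Ax_mul_self {S Sx Sy : ℝ × ℝ → M2} {p : ℝ × ℝ} (h : S p * S p = -1)
    (hx : S p * Sx p = -(Sx p * S p)) (hy : S p * Sy p = -(Sy p * S p)) :
    Ax S Sx Sy p * S p = -Ay S Sx Sy p := by
  rw [Ay, Ax, smul_mul_assoc, hx, hy, add_mul, neg_mul, mul_assoc (Sx p), h, mul_neg,
    mul_one, neg_neg, ← smul_neg, neg_add, neg_neg, neg_neg, add_comm]

theorem stmt11
    (U : Set (ℝ × ℝ)) (hU : IsOpen U)
    (S Sx Sy : ℝ × ℝ → M2)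
    (hSsm : ContDiffOn ℝ (⊤ : ℕ∞) S U)
    (hSx : ∀ p ∈ U, HasDerivAt (fun t => S (t, p.2)) (Sx p) p.1)
    (hSy : ∀ p ∈ U, HasDerivAt (fun t => S (p.1, t)) (Sy p) p.2)
    (hS2 : ∀ p ∈ U, S p * S p = -1)
    -- S is harmonic: ∂ₓA_x + ∂_yA_y = 0 on U
    (Axx Ayy : ℝ × ℝ → M2)
    (hAxx : ∀ p ∈ U, HasDerivAt (fun t => Ax S Sx Sy (t, p.2)) (Axx p) p.1)
    (hAyy : ∀ p ∈ U, HasDerivAt (fun t => Ay S Sx Sy (p.1, t)) (Ayy p) p.2)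
    (hharm : ∀ p ∈ U, Axx p + Ayy p = 0)
    -- fixed spectral parameter μ ∈ ℂ*
    (μ : ℂ) (hμ0 : μ ≠ 0)
    -- two d^μ-parallel sections ψ₁, ψ₂ whose frame G is invertible
    (ψ1 ψ2 : ℝ × ℝ → (Fin 2 → Hq))
    (hψ1sm : ContDiffOn ℝ (⊤ : ℕ∞) ψ1 U) (hψ2sm : ContDiffOn ℝ (⊤ : ℕ∞) ψ2 U)
    (hψ1x : ∀ p ∈ U, HasDerivAt (fun t => ψ1 (t, p.2)) (-(omx S Sx Sy μ p (ψ1 p))) p.1)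
    (hψ1y : ∀ p ∈ U, HasDerivAt (fun t => ψ1 (p.1, t)) (-(omy S Sx Sy μ p (ψ1 p))) p.2)
    (hψ2x : ∀ p ∈ U, HasDerivAt (fun t => ψ2 (t, p.2)) (-(omx S Sx Sy μ p (ψ2 p))) p.1)
    (hψ2y : ∀ p ∈ U, HasDerivAt (fun t => ψ2 (p.1, t)) (-(omy S Sx Sy μ p (ψ2 p))) p.2)
    (hGu : ∀ p ∈ U, IsUnit (Gm (ψ1 p) (ψ2 p))) :
    ∀ p ∈ U,
      -- ∂ₓa = −[A_y T, a − E₂]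
      HasDerivAt (fun t => af μ ψ1 ψ2 (t, p.2))
        (-(Ay S Sx Sy p * Tf S μ ψ1 ψ2 p * (af μ ψ1 ψ2 p - 1)
            - (af μ ψ1 ψ2 p - 1) * (Ay S Sx Sy p * Tf S μ ψ1 ψ2 p))) p.1 ∧
      -- ∂_ya = [A_x T, a − E₂]
      HasDerivAt (fun t => af μ ψ1 ψ2 (p.1, t))
        (Ax S Sx Sy p * Tf S μ ψ1 ψ2 p * (af μ ψ1 ψ2 p - 1)
            - (af μ ψ1 ψ2 p - 1) * (Ax S Sx Sy p * Tf S μ ψ1 ψ2 p)) p.2 ∧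
      -- ∂ₓb = −[A_y T, b]
      HasDerivAt (fun t => bf μ ψ1 ψ2 (t, p.2))
        (-(Ay S Sx Sy p * Tf S μ ψ1 ψ2 p * bf μ ψ1 ψ2 p
            - bf μ ψ1 ψ2 p * (Ay S Sx Sy p * Tf S μ ψ1 ψ2 p))) p.1 ∧
      -- ∂_yb = [A_x T, b]
      HasDerivAt (fun t => bf μ ψ1 ψ2 (p.1, t))
        (Ax S Sx Sy p * Tf S μ ψ1 ψ2 p * bf μ ψ1 ψ2 p
            - bf μ ψ1 ψ2 p * (Ax S Sx Sy p * Tf S μ ψ1 ψ2 p)) p.2 := by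
  intro p hp
  have hx : S p * Sx p = -(Sx p * S p) := by
    refine matrix_mul_deriv_eq_neg (hSx p hp) ?_
    have hc : ContinuousAt (fun t : ℝ => (t, p.2)) p.1 := by fun_prop
    filter_upwards [hc.preimage_mem_nhds (hU.mem_nhds hp)] with t ht using hS2 _ ht
  have hy : S p * Sy p = -(Sy p * S p) := by
    refine matrix_mul_deriv_eq_neg (hSy p hp) ?_
    have hc : ContinuousAt (fun t : ℝ => (p.1, t)) p.2 := by fun_prop
    filter_upwards [hc.preimage_mem_nhds (hU.mem_nhds hp)] with t ht using hS2 _ ht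
  have hAy := Ay_mul_self (hS2 p hp) hx hy
  have hAx := Ax_mul_self (hS2 p hp) hx hy
  have hGx := (hasDerivAt_Gm (hψ1x p hp) (hψ2x p hp)).congr_deriv
    (Gm_neg_omx S Sx Sy μ p (hGu p hp))
  have hGy := (hasDerivAt_Gm (hψ1y p hp) (hψ2y p hp)).congr_deriv
    (Gm_neg_omy S Sx Sy μ p (hGu p hp))
  have hwx : -(Ax S Sx Sy p * (af μ ψ1 ψ2 p - 1) + Ay S Sx Sy p * bf μ ψ1 ψ2 p)
      = -(Ay S Sx Sy p * Tf S μ ψ1 ψ2 p) := by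
    rw [← hAy, mul_assoc, ← mul_add]; rfl
  have hwy : -(Ay S Sx Sy p * (af μ ψ1 ψ2 p - 1) - Ax S Sx Sy p * bf μ ψ1 ψ2 p)
      = Ax S Sx Sy p * Tf S μ ψ1 ψ2 p := by
    rw [neg_sub, sub_eq_add_neg, ← neg_mul, ← hAx, mul_assoc, add_comm, ← mul_add]; rfl
  change HasDerivAt _ (-(Ax S Sx Sy p * (af μ ψ1 ψ2 p - 1) + Ay S Sx Sy p * bf μ ψ1 ψ2 p)
    * _) _ at hGx
  change HasDerivAt _ (-(Ay S Sx Sy p * (af μ ψ1 ψ2 p - 1) - Ax S Sx Sy p * bf μ ψ1 ψ2 p)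
    * _) _ at hGy
  rw [hwx] at hGx
  rw [hwy] at hGy
  refine ⟨?_, ?_, ?_, ?_⟩
  · refine (hasDerivAt_matrix_conj_inverse hGx (hGu p hp)).congr_deriv ?_
    change -(_ * _) * af μ ψ1 ψ2 p - af μ ψ1 ψ2 p * _ = _
    noncomm_ring
  · refine (hasDerivAt_matrix_conj_inverse hGy (hGu p hp)).congr_deriv ?_
    change _ * _ * af μ ψ1 ψ2 p - af μ ψ1 ψ2 p * _ = _
    noncomm_ring
  · refine (hasDerivAt_matrix_conj_inverse hGx (hGu p hp)).congr_deriv ?_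
    change -(_ * _) * bf μ ψ1 ψ2 p - bf μ ψ1 ψ2 p * _ = _
    noncomm_ring
  · exact hasDerivAt_matrix_conj_inverse hGy (hGu p hp)
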